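/- Let X be a complex Banach space. The set UC(ℝ,X) + g·UC(ℝ,X) = {u + g·v : u, v ∈ UC(ℝ,X)} is closed under uniform convergence on ℝ: if (f_n) is a sequence of functions with f_n = u_n + g·v_n for some u_n, v_n ∈ UC(ℝ,X), and f_n converges to f : ℝ → X uniformly on ℝ, then f = u + g·v for some u, v ∈ UC(ℝ,X). -/

import Mathlib

open Filter

noncomputable def g (t : ℝ) : ℂ := Complex.exp (Complex.I * (t : ℂ) ^ 2)

noncomputable def sig (t : ℝ) : ℝ := t * √(1 + Real.pi / max (t ^ 2) 1)

lemma sig_cont : Continuous sig := by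
  unfold sig
  refine continuous_id.mul (Real.continuous_sqrt.comp (continuous_const.add
    (continuous_const.div ((continuous_id.pow 2).max continuous_const) ?_)))
  intro t
  have : (1:ℝ) ≤ max (t ^ 2) 1 := le_max_right _ _
  positivity

lemma g_cont : Continuous g := by unfold g; fun_prop

lemma g_norm (t : ℝ) : ‖g t‖ = 1 := by
  unfold g
  rw [mul_comm]
  exact_mod_cast Complex.norm_exp_ofReal_mul_I (t ^ (2 : ℕ))

lemma g_ne (t : ℝ) : g t ≠ 0 := Complex.exp_ne_zero _

lemma abs_large (c : ℝ) : ∀ᶠ t : ℝ in cocompact ℝ, c ≤ |t| :=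
  (tendsto_norm_cocompact_atTop (E := ℝ)).eventually_ge_atTop c

lemma sig_sq {t : ℝ} (ht : 1 ≤ |t|) : sig t ^ 2 = t ^ 2 + Real.pi := by
  have h1 : 1 ≤ t ^ 2 := by rw [← sq_abs]; nlinarith
  have hp := Real.pi_pos
  unfold sig
  rw [max_eq_left h1, mul_pow, Real.sq_sqrt (by positivity)]
  have h0 : t ^ 2 ≠ 0 := by positivity
  rw [mul_add, mul_one, mul_div_cancel₀ _ h0]

lemma g_sig {t : ℝ} (ht : 1 ≤ |t|) : g (sig t) = - g t := by
  unfold g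
  have h : ((sig t : ℂ)) ^ 2 = (t : ℂ) ^ 2 + Real.pi := by exact_mod_cast sig_sq ht
  rw [h, mul_add, Complex.exp_add, mul_comm Complex.I (Real.pi : ℂ), Complex.exp_pi_mul_I]
  ring

lemma sig_close {t : ℝ} (ht : 1 ≤ |t|) : |sig t - t| ≤ Real.pi / |t| := by
  have h1 : 1 ≤ t ^ 2 := by rw [← sq_abs]; nlinarith
  have hp := Real.pi_pos
  have h2 : √(1 + Real.pi / t ^ 2) ≤ 1 + Real.pi / t ^ 2 / 2 :=
    Real.sqrt_one_add_le (by have : 0 < Real.pi / t ^ 2 := by positivity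
                             linarith)
  have h3 : 1 ≤ √(1 + Real.pi / t ^ 2) := by
    rw [Real.one_le_sqrt]
    have : 0 < Real.pi / t ^ 2 := by positivity
    linarith
  unfold sig
  rw [max_eq_left h1, show t * √(1 + Real.pi / t ^ 2) - t = t * (√(1 + Real.pi / t ^ 2) - 1) by ring,
    abs_mul, abs_of_nonneg (sub_nonneg.2 h3)]
  have h4 : Real.pi / |t| = |t| * (Real.pi / t ^ 2) := by
    rw [← sq_abs]
    have : |t| ≠ 0 := by positivity
    field_simp
  rw [h4]
  have : 0 < Real.pi / t ^ 2 := by positivity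
  gcongr
  linarith

lemma sig_tendsto : Tendsto (fun t => sig t - t) (cocompact ℝ) (nhds 0) := by
  have h : Tendsto (fun t : ℝ => Real.pi / |t|) (cocompact ℝ) (nhds 0) :=
    tendsto_const_nhds.div_atTop (tendsto_norm_cocompact_atTop (E := ℝ))
  refine squeeze_zero_norm' ?_ h
  filter_upwards [abs_large 1] with t ht using sig_close ht

lemma uc_diff {X : Type*} [NormedAddCommGroup X] {u : ℝ → X} (hu : UniformContinuous u) :
    Tendsto (fun t => u (sig t) - u t) (cocompact ℝ) (nhds 0) := by
  rw [Metric.uniformContinuous_iff] at hu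
  rw [Metric.tendsto_nhds]
  intro ε hε
  obtain ⟨δ, hδ, H⟩ := hu ε hε
  filter_upwards [(Metric.tendsto_nhds.1 sig_tendsto) δ hδ] with t ht
  rw [dist_zero_right, ← dist_eq_norm]
  apply H
  rwa [dist_zero_right, ← dist_eq_norm] at ht

section
variable {X : Type*} [NormedAddCommGroup X] [NormedSpace ℂ X]

noncomputable def errD (u v : ℝ → X) (t : ℝ) : X :=
  (u (sig t) - u t) + (g t • v t + g (sig t) • v (sig t))

lemma errD_cont {u v : ℝ → X} (hu : Continuous u) (hv : Continuous v) :
    Continuous (errD u v) := by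
  have := sig_cont
  have := g_cont
  unfold errD
  fun_prop

lemma errD_tendsto {u v : ℝ → X} (hu : UniformContinuous u) (hv : UniformContinuous v) :
    Tendsto (errD u v) (cocompact ℝ) (nhds 0) := by
  have h1 := (uc_diff hu).norm.add (uc_diff hv).norm
  simp only [norm_zero, add_zero] at h1
  refine squeeze_zero_norm' ?_ h1
  filter_upwards [abs_large 1] with t ht
  unfold errD
  refine (norm_add_le _ _).trans ?_
  rw [g_sig ht, neg_smul, ← sub_eq_add_neg, ← smul_sub, norm_smul, g_norm, one_mul,
    norm_sub_rev (v t)]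

lemma uc_of {e : ℝ → X} (he : Continuous e) (h : Tendsto e (cocompact ℝ) (nhds 0))
    {c : ℝ → ℂ} (hc : Continuous c) (hn : ∀ t, ‖c t‖ ≤ 1) :
    UniformContinuous (fun t => c t • e t) := by
  refine (hc.smul he).uniformContinuous_of_tendsto_cocompact (x := 0) ?_
  have h1 := h.norm
  rw [norm_zero] at h1
  refine squeeze_zero_norm (fun t => ?_) h1
  rw [norm_smul]
  exact mul_le_of_le_one_left (norm_nonneg _) (hn t)

end

theorem stmt4 (X : Type*) [NormedAddCommGroup X] [NormedSpace ℂ X] [CompleteSpace X]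
    (u v : ℕ → ℝ → X) (hu : ∀ n, UniformContinuous (u n)) (hv : ∀ n, UniformContinuous (v n))
    (f : ℝ → X)
    (hconv : TendstoUniformly (fun n t => u n t + g t • v n t) f atTop) :
    ∃ u' v' : ℝ → X, UniformContinuous u' ∧ UniformContinuous v' ∧
      ∀ t, f t = u' t + g t • v' t := by
  have hD := fun n => errD_cont (hu n).continuous (hv n).continuous
  have hT := fun n => errD_tendsto (hu n) (hv n)
  have hg1 : Continuous (fun t => (1/2 : ℂ) * (g t)⁻¹) :=
    continuous_const.mul (g_cont.inv₀ g_ne)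
  have hg2 : ∀ t, ‖(1/2 : ℂ) * (g t)⁻¹‖ = 1/2 := by
    intro t; rw [norm_mul, norm_inv, g_norm]; norm_num
  refine ⟨fun t => (1/2 : ℂ) • (f t + f (sig t)),
    fun t => ((1/2 : ℂ) * (g t)⁻¹) • (f t - f (sig t)), ?_, ?_, ?_⟩
  · have key : TendstoUniformly (fun n t => u n t + (1/2 : ℂ) • errD (u n) (v n) t)
        (fun t => (1/2 : ℂ) • (f t + f (sig t))) atTop := by
      rw [Metric.tendstoUniformly_iff] at hconv ⊢
      intro ε hε
      filter_upwards [hconv ε hε] with n hn t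
      have e : (1/2 : ℂ) • (f t + f (sig t)) - (u n t + (1/2 : ℂ) • errD (u n) (v n) t)
          = (1/2 : ℂ) • ((f t - (u n t + g t • v n t)) +
            (f (sig t) - (u n (sig t) + g (sig t) • v n (sig t)))) := by
        unfold errD; module
      have a := hn t
      have b := hn (sig t)
      rw [dist_eq_norm] at a b ⊢
      rw [e, norm_smul, show ‖(1/2 : ℂ)‖ = 1/2 by norm_num]
      have := norm_add_le (f t - (u n t + g t • v n t))
        (f (sig t) - (u n (sig t) + g (sig t) • v n (sig t)))
      linarith
    refine key.uniformContinuous (Eventually.frequently (Eventually.of_forall fun n => ?_))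
    exact (hu n).add (uc_of (hD n) (hT n) continuous_const (fun _ => by norm_num))
  · have key : TendstoUniformly
        (fun n t => v n t - ((1/2 : ℂ) * (g t)⁻¹) • errD (u n) (v n) t)
        (fun t => ((1/2 : ℂ) * (g t)⁻¹) • (f t - f (sig t))) atTop := by
      rw [Metric.tendstoUniformly_iff] at hconv ⊢
      intro ε hε
      filter_upwards [hconv ε hε] with n hn t
      have e : ((1/2 : ℂ) * (g t)⁻¹) • (f t - f (sig t)) -
            (v n t - ((1/2 : ℂ) * (g t)⁻¹) • errD (u n) (v n) t)
          = ((1/2 : ℂ) * (g t)⁻¹) • ((f t - (u n t + g t • v n t)) -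
            (f (sig t) - (u n (sig t) + g (sig t) • v n (sig t)))) := by
        have hv1 : v n t = ((1/2 : ℂ) * (g t)⁻¹) • ((2 : ℂ) • g t • v n t) := by
          rw [smul_smul, smul_smul]
          have := g_ne t
          rw [show (1/2 : ℂ) * (g t)⁻¹ * 2 * g t = 1 by field_simp, one_smul]
        nth_rw 1 [hv1]
        unfold errD
        rw [← smul_sub, ← smul_sub]
        congr 1
        module
      have a := hn t
      have b := hn (sig t)
      rw [dist_eq_norm] at a b ⊢
      rw [e, norm_smul, hg2]
      have := norm_sub_le (f t - (u n t + g t • v n t))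
        (f (sig t) - (u n (sig t) + g (sig t) • v n (sig t)))
      linarith
    refine key.uniformContinuous (Eventually.frequently (Eventually.of_forall fun n => ?_))
    exact (hv n).sub (uc_of (hD n) (hT n) hg1 (fun t => by rw [hg2]; norm_num))
  · intro t
    have := g_ne t
    simp only [smul_smul]
    rw [show g t * (1/2 * (g t)⁻¹) = 1/2 by field_simp]
    module
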